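/- Let λ > 0, α ∈ (1,2) and C_α > 0, and let g and F be as defined. Then there exists a constant c₁ > 0 such that for all u > 0 and all x, x̃ ∈ ℝ, writing v := |x − x̃|: −λ·v·∂_2F(u,v) + u·∫_0^∞ ( F(u, |x − x̃ + z|) − F(u, v) − ∂_2F(u, v)·σ·z ) ν_α(dz) ≤ −λ·v·1_{{v ≥ 2u}} + c₁·(u + u^{2−α}). -/

import Mathlib

open Set MeasureTheory

/-- The Lévy measure of a spectrally positive `α`-stable process:
`ν_α(dz) = C_α z^{-(1+α)} 1_{z>0} dz`. -/
noncomputable def nuMeasure (Cα α : ℝ) : Measure ℝ :=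
  (volume.restrict (Ioi (0 : ℝ))).withDensity fun z => ENNReal.ofReal (Cα * z ^ (-(1 + α)))

/-- The cutoff function `g` from the paper. -/
def IsCutoff (δ : ℝ) (g : ℝ → ℝ) : Prop :=
  ContDiffOn ℝ 2 g (Ici 0) ∧
  (∃ M : ℝ, ∀ r ∈ Ici (0 : ℝ), |g r| ≤ M ∧ |deriv g r| ≤ M ∧ |deriv (deriv g) r| ≤ M) ∧
  MonotoneOn g (Ici 0) ∧
  (∀ r ∈ Ici (0 : ℝ), g r ∈ Icc (0 : ℝ) 1) ∧
  (∀ r : ℝ, 0 ≤ r → r ≤ 1 → g r = 0) ∧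
  (∀ r : ℝ, 1 < r → r < 3 / 2 → g r = (r - 1) ^ (2 + δ)) ∧
  (∀ r : ℝ, 2 ≤ r → g r = 1)

/-- `F(s,t) = (1 - g(t/s))·s + g(t/s)·t` for `s ≠ 0`, and `F(0,t) = t`. -/
noncomputable def Fcut (g : ℝ → ℝ) (s t : ℝ) : ℝ :=
  if s = 0 then t else (1 - g (t / s)) * s + g (t / s) * t

/-- `V_{c,θ}(s,t) = c(s + s^θ) + F(s,t)`. -/
noncomputable def Vct (g : ℝ → ℝ) (c θ s t : ℝ) : ℝ :=
  c * (s + s ^ θ) + Fcut g s t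

/-- first partial derivative in the first argument -/
noncomputable def D1 (G : ℝ → ℝ → ℝ) (s t : ℝ) : ℝ := deriv (fun a => G a t) s

/-- first partial derivative in the second argument -/
noncomputable def D2 (G : ℝ → ℝ → ℝ) (s t : ℝ) : ℝ := deriv (fun a => G s a) t

/-- second partial derivative in the first argument -/
noncomputable def D11 (G : ℝ → ℝ → ℝ) (s t : ℝ) : ℝ := deriv (fun a => D1 G a t) s

/-- `σ = (x - x̃)/|x - x̃|` for `x ≠ x̃`, and `σ = 1` for `x = x̃`. -/
noncomputable def sgn' (x xt : ℝ) : ℝ := if x = xt then 1 else (x - xt) / |x - xt|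

/-- The profile `r ↦ F(1, r)` for `r ≥ 0`, extended by `1` to the negative half-line. -/
noncomputable def cutProfile (g : ℝ → ℝ) (r : ℝ) : ℝ :=
  if r < 1 then 1 else 1 + g r * (r - 1)

lemma cutProfile_of_le_one (g : ℝ → ℝ) {r : ℝ} (hr : r ≤ 1) : cutProfile g r = 1 := by
  rcases hr.lt_or_eq with h | rfl
  · simp [cutProfile, h]
  · simp [cutProfile]

lemma IsCutoff.cutProfile_of_nonneg {δ : ℝ} {g : ℝ → ℝ} (hg : IsCutoff δ g) {r : ℝ}
    (hr : 0 ≤ r) : cutProfile g r = 1 + g r * (r - 1) := by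
  unfold cutProfile
  split_ifs with h
  · simp [hg.2.2.2.2.1 r hr h.le]
  · rfl

lemma IsCutoff.cutProfile_of_two_le {δ : ℝ} {g : ℝ → ℝ} (hg : IsCutoff δ g) {r : ℝ}
    (hr : 2 ≤ r) : cutProfile g r = r := by
  rw [hg.cutProfile_of_nonneg (by linarith), hg.2.2.2.2.2.2 r hr]
  ring

lemma IsCutoff.contDiff_cutProfile {δ : ℝ} {g : ℝ → ℝ} (hg : IsCutoff δ g) :
    ContDiff ℝ 2 (cutProfile g) := by
  rw [contDiff_iff_contDiffAt]
  intro r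
  by_cases hr : r < 1
  · refine (contDiffAt_const (c := (1 : ℝ))).congr_of_eventuallyEq ?_
    filter_upwards [Iio_mem_nhds hr] with s hs
    exact cutProfile_of_le_one g (le_of_lt hs)
  · have h0 : (0 : ℝ) < r := by linarith
    have hgr : ContDiffAt ℝ 2 g r := hg.1.contDiffAt (Ici_mem_nhds h0)
    refine (contDiffAt_const.add (hgr.mul (contDiffAt_id.sub contDiffAt_const)) :
      ContDiffAt ℝ 2 (fun s => 1 + g s * (s - 1)) r).congr_of_eventuallyEq ?_
    filter_upwards [Ioi_mem_nhds h0] with s hs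
    exact hg.cutProfile_of_nonneg (le_of_lt hs)

lemma IsCutoff.differentiable_cutProfile {δ : ℝ} {g : ℝ → ℝ} (hg : IsCutoff δ g) :
    Differentiable ℝ (cutProfile g) :=
  hg.contDiff_cutProfile.differentiable (by norm_num)

lemma IsCutoff.contDiff_deriv_cutProfile {δ : ℝ} {g : ℝ → ℝ} (hg : IsCutoff δ g) :
    ContDiff ℝ 1 (deriv (cutProfile g)) :=
  hg.contDiff_cutProfile.deriv'

lemma IsCutoff.monotone_cutProfile {δ : ℝ} {g : ℝ → ℝ} (hg : IsCutoff δ g) :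
    Monotone (cutProfile g) := by
  intro a b hab
  rcases le_total a 1 with ha | ha
  · rw [cutProfile_of_le_one g ha]
    rcases le_total b 1 with hb | hb
    · rw [cutProfile_of_le_one g hb]
    · rw [hg.cutProfile_of_nonneg (by linarith)]
      have := (hg.2.2.2.1 b (by simp only [mem_Ici]; linarith)).1
      nlinarith
  · have ha0 : a ∈ Ici (0 : ℝ) := by simp only [mem_Ici]; linarith
    have hb0 : b ∈ Ici (0 : ℝ) := by simp only [mem_Ici]; linarith
    rw [hg.cutProfile_of_nonneg ha0, hg.cutProfile_of_nonneg hb0]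
    have h1 := hg.2.2.1 ha0 hb0 hab
    have h2 := (hg.2.2.2.1 b hb0).1
    have := mul_le_mul h1 (by linarith : a - 1 ≤ b - 1) (by linarith) h2
    linarith

lemma IsCutoff.deriv_cutProfile_of_le_one {δ : ℝ} {g : ℝ → ℝ} (hg : IsCutoff δ g) {r : ℝ}
    (hr : r ≤ 1) : deriv (cutProfile g) r = 0 := by
  have h1 := (hg.differentiable_cutProfile r).hasDerivAt.hasDerivWithinAt (s := Iic 1)
  have h2 : HasDerivWithinAt (cutProfile g) 0 (Iic 1) r :=
    (hasDerivWithinAt_const r (Iic 1) (1 : ℝ)).congr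
      (fun s hs => cutProfile_of_le_one g hs) (cutProfile_of_le_one g hr)
  exact (uniqueDiffOn_Iic 1 r hr).eq_deriv _ h1 h2

lemma IsCutoff.deriv_cutProfile_of_two_le {δ : ℝ} {g : ℝ → ℝ} (hg : IsCutoff δ g) {r : ℝ}
    (hr : 2 ≤ r) : deriv (cutProfile g) r = 1 := by
  have h1 := (hg.differentiable_cutProfile r).hasDerivAt.hasDerivWithinAt (s := Ici 2)
  have h2 : HasDerivWithinAt (cutProfile g) 1 (Ici 2) r :=
    (hasDerivWithinAt_id r (Ici 2)).congr
      (fun s hs => hg.cutProfile_of_two_le hs) (hg.cutProfile_of_two_le hr)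
  exact (uniqueDiffOn_Ici 2 r hr).eq_deriv _ h1 h2

lemma exists_abs_le_of_continuous_of_abs_le_outside {f : ℝ → ℝ} {a b m : ℝ} (hf : Continuous f)
    (hout : ∀ x, x < a ∨ b < x → |f x| ≤ m) : ∃ K : ℝ, 0 ≤ K ∧ ∀ x, |f x| ≤ K := by
  obtain ⟨C, hC⟩ := (isCompact_Icc (a := a) (b := b)).exists_bound_of_continuousOn hf.continuousOn
  refine ⟨max 0 (max C m), le_max_left _ _, fun x => ?_⟩
  by_cases hx : x ∈ Icc a b
  · exact (hC x hx).trans ((le_max_left _ _).trans (le_max_right _ _))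
  · refine (hout x ?_).trans ((le_max_right _ _).trans (le_max_right _ _))
    by_contra! h
    exact hx h

lemma IsCutoff.exists_abs_deriv_cutProfile_le {δ : ℝ} {g : ℝ → ℝ} (hg : IsCutoff δ g) :
    ∃ L : ℝ, 0 ≤ L ∧ ∀ r, |deriv (cutProfile g) r| ≤ L := by
  refine exists_abs_le_of_continuous_of_abs_le_outside (a := 1) (b := 2) (m := 1)
    hg.contDiff_deriv_cutProfile.continuous ?_
  rintro r (hr | hr)
  · simp [hg.deriv_cutProfile_of_le_one hr.le]
  · simp [hg.deriv_cutProfile_of_two_le hr.le]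

lemma IsCutoff.exists_abs_deriv_deriv_cutProfile_le {δ : ℝ} {g : ℝ → ℝ} (hg : IsCutoff δ g) :
    ∃ K : ℝ, 0 ≤ K ∧ ∀ r, |deriv (deriv (cutProfile g)) r| ≤ K := by
  refine exists_abs_le_of_continuous_of_abs_le_outside (a := 1) (b := 2) (m := 0)
    (hg.contDiff_deriv_cutProfile.continuous_deriv le_rfl) ?_
  rintro r (hr | hr)
  · have : deriv (cutProfile g) =ᶠ[nhds r] fun _ => 0 := by
      filter_upwards [Iio_mem_nhds hr] with s hs
      exact hg.deriv_cutProfile_of_le_one (le_of_lt hs)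
    simp [this.deriv_eq]
  · have : deriv (cutProfile g) =ᶠ[nhds r] fun _ => 1 := by
      filter_upwards [Ioi_mem_nhds hr] with s hs
      exact hg.deriv_cutProfile_of_two_le (le_of_lt hs)
    simp [this.deriv_eq]

lemma abs_sub_sub_deriv_mul_le_of_abs_deriv_le {f : ℝ → ℝ} {L : ℝ} (hf : Differentiable ℝ f)
    (hL : ∀ x, |deriv f x| ≤ L) (a b : ℝ) :
    |f (a + b) - f a - deriv f a * b| ≤ 2 * L * |b| := by
  have h1 : |f (a + b) - f a| ≤ L * |b| := by
    have := convex_univ.norm_image_sub_le_of_norm_deriv_le (f := f) (C := L)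
      (fun x _ => hf x) (fun x _ => hL x) (mem_univ a) (mem_univ (a + b))
    simpa using this
  have h2 : |deriv f a * b| ≤ L * |b| := by
    rw [abs_mul]
    exact mul_le_mul_of_nonneg_right (hL a) (abs_nonneg b)
  have := abs_sub (f (a + b) - f a) (deriv f a * b)
  linarith

lemma abs_sub_sub_deriv_mul_le_of_abs_deriv_deriv_le {f : ℝ → ℝ} {K : ℝ}
    (hf : Differentiable ℝ f) (hf' : Differentiable ℝ (deriv f))
    (hK : ∀ x, |deriv (deriv f) x| ≤ K) (a b : ℝ) :
    |f (a + b) - f a - deriv f a * b| ≤ K * b ^ 2 := by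
  have hK0 : 0 ≤ K := (abs_nonneg _).trans (hK a)
  have hlip (x : ℝ) : |deriv f x - deriv f a| ≤ K * |x - a| :=
    convex_univ.norm_image_sub_le_of_norm_deriv_le (f := deriv f) (C := K)
      (fun x _ => hf' x) (fun x _ => hK x) (mem_univ a) (mem_univ x)
  have hder (x : ℝ) :
      HasDerivAt (fun x => f x - deriv f a * x) (deriv f x - deriv f a) x := by
    have h := (hf x).hasDerivAt.sub ((hasDerivAt_id x).const_mul (deriv f a))
    rw [mul_one] at h
    exact h
  have := (convex_closedBall a |b|).norm_image_sub_le_of_norm_hasDerivWithin_le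
    (f := fun x => f x - deriv f a * x) (C := K * |b|) (x := a) (y := a + b)
    (fun x _ => (hder x).hasDerivWithinAt)
    (fun x hx => (hlip x).trans (by
      rw [mem_closedBall_iff_norm, Real.norm_eq_abs] at hx
      gcongr)) (by simp) (by simp)
  rw [Real.norm_eq_abs, Real.norm_eq_abs, add_sub_cancel_left, mul_assoc, abs_mul_abs_self] at this
  convert this using 1
  · congr 1; ring
  · ring

lemma cutProfile_abs (g : ℝ → ℝ) (r : ℝ) :
    cutProfile g |r| = cutProfile g r + cutProfile g (-r) - 1 := by
  rcases le_total 0 r with h | h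
  · rw [abs_of_nonneg h, cutProfile_of_le_one g (by linarith : -r ≤ 1)]; ring
  · rw [abs_of_nonpos h, cutProfile_of_le_one g (by linarith : r ≤ 1)]; ring

lemma IsCutoff.Fcut_eq {δ : ℝ} {g : ℝ → ℝ} (hg : IsCutoff δ g) {u t : ℝ} (hu : 0 < u)
    (ht : 0 ≤ t) : Fcut g u t = u * cutProfile g (t / u) := by
  rw [hg.cutProfile_of_nonneg (by positivity), Fcut, if_neg hu.ne']
  field_simp
  ring

lemma IsCutoff.D2_Fcut {δ : ℝ} {g : ℝ → ℝ} (hg : IsCutoff δ g) {u v : ℝ} (hu : 0 < u)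
    (hv : 0 ≤ v) : D2 (Fcut g) u v = deriv (cutProfile g) (v / u) := by
  unfold D2
  have hder : HasDerivAt (fun a => u * cutProfile g (a / u)) (deriv (cutProfile g) (v / u)) v := by
    have h1 : HasDerivAt (fun a => a / u) (1 / u) v := (hasDerivAt_id v).div_const u
    have h2 := (((hg.differentiable_cutProfile (v / u)).hasDerivAt).comp v h1).const_mul u
    rwa [mul_left_comm, mul_one_div_cancel hu.ne', mul_one] at h2
  rcases hv.eq_or_lt with rfl | hv
  · by_cases hd : DifferentiableAt ℝ (fun a => Fcut g u a) 0
    · exact (uniqueDiffOn_Ici (0 : ℝ) 0 self_mem_Ici).eq_deriv _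
        (hd.hasDerivAt.hasDerivWithinAt)
        (hder.hasDerivWithinAt.congr (fun s hs => hg.Fcut_eq hu hs) (hg.Fcut_eq hu le_rfl))
    · rw [deriv_zero_of_not_differentiableAt hd, zero_div,
        hg.deriv_cutProfile_of_le_one zero_le_one]
  · refine (hder.congr_of_eventuallyEq ?_).deriv
    filter_upwards [Ioi_mem_nhds hv] with s hs
    exact hg.Fcut_eq hu (le_of_lt hs)

lemma IsCutoff.D2_Fcut_mul_sgn {δ : ℝ} {g : ℝ → ℝ} (hg : IsCutoff δ g) {u : ℝ} (hu : 0 < u)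
    (x xt : ℝ) : D2 (Fcut g) u |x - xt| * sgn' x xt =
      deriv (cutProfile g) ((x - xt) / u) - deriv (cutProfile g) (-((x - xt) / u)) := by
  rw [hg.D2_Fcut hu (abs_nonneg _), sgn']
  rcases lt_trichotomy (x - xt) 0 with h | h | h
  · have hneg : (x - xt) / u ≤ 1 := (div_nonpos_of_nonpos_of_nonneg h.le hu.le).trans zero_le_one
    rw [if_neg (by rintro rfl; simp at h), abs_of_neg h, div_neg, div_self h.ne,
      hg.deriv_cutProfile_of_le_one hneg, neg_div]
    ring
  · rw [if_pos (by linarith), h]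
    simp [hg.deriv_cutProfile_of_le_one zero_le_one]
  · have hneg : -((x - xt) / u) ≤ 1 := by
      have : 0 < (x - xt) / u := by positivity
      linarith
    rw [if_neg (by rintro rfl; simp at h), abs_of_pos h, div_self h.ne',
      hg.deriv_cutProfile_of_le_one hneg]
    ring

lemma IsCutoff.Fcut_increment_eq {δ : ℝ} {g : ℝ → ℝ} (hg : IsCutoff δ g) {u : ℝ} (hu : 0 < u)
    (x xt z : ℝ) :
    Fcut g u |x - xt + z| - Fcut g u |x - xt| - D2 (Fcut g) u |x - xt| * sgn' x xt * z =
      u * ((cutProfile g ((x - xt) / u + z / u) - cutProfile g ((x - xt) / u)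
          - deriv (cutProfile g) ((x - xt) / u) * (z / u)) +
        (cutProfile g (-((x - xt) / u) + -(z / u)) - cutProfile g (-((x - xt) / u))
          - deriv (cutProfile g) (-((x - xt) / u)) * (-(z / u)))) := by
  have habs (t : ℝ) : Fcut g u |t| = u * (cutProfile g (t / u) + cutProfile g (-(t / u)) - 1) := by
    rw [hg.Fcut_eq hu (abs_nonneg t), ← cutProfile_abs, abs_div, abs_of_pos hu]
  rw [habs, habs, hg.D2_Fcut_mul_sgn hu, add_div, neg_add]
  field_simp
  ring

/-- The compensated increments of `F(u, |·|)` are `O(z² / u)` and `O(z)`. -/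
lemma IsCutoff.exists_abs_Fcut_increment_le {δ : ℝ} {g : ℝ → ℝ} (hg : IsCutoff δ g) :
    ∃ A : ℝ, 0 < A ∧ ∀ u x xt z : ℝ, 0 < u → 0 < z →
      |Fcut g u |x - xt + z| - Fcut g u |x - xt| - D2 (Fcut g) u |x - xt| * sgn' x xt * z|
          ≤ A * z ^ 2 / u ∧
      |Fcut g u |x - xt + z| - Fcut g u |x - xt| - D2 (Fcut g) u |x - xt| * sgn' x xt * z|
          ≤ A * z := by
  obtain ⟨L, hL0, hL⟩ := hg.exists_abs_deriv_cutProfile_le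
  obtain ⟨K, hK0, hK⟩ := hg.exists_abs_deriv_deriv_cutProfile_le
  have hd := hg.differentiable_cutProfile
  have hd' := hg.contDiff_deriv_cutProfile.differentiable (by norm_num)
  refine ⟨2 * K + 4 * L + 1, by linarith, fun u x xt z hu hz => ?_⟩
  rw [hg.Fcut_increment_eq hu, abs_mul, abs_of_pos hu]
  set y := (x - xt) / u
  have hzu : 0 < z / u := by positivity
  constructor
  · have h1 := abs_sub_sub_deriv_mul_le_of_abs_deriv_deriv_le hd hd' hK y (z / u)
    have h2 := abs_sub_sub_deriv_mul_le_of_abs_deriv_deriv_le hd hd' hK (-y) (-(z / u))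
    rw [neg_sq] at h2
    calc _ ≤ u * (K * (z / u) ^ 2 + K * (z / u) ^ 2) :=
          mul_le_mul_of_nonneg_left ((abs_add_le _ _).trans (add_le_add h1 h2)) hu.le
      _ = (2 * K) * z ^ 2 / u := by field_simp; ring
      _ ≤ _ := by gcongr; linarith
  · have h1 := abs_sub_sub_deriv_mul_le_of_abs_deriv_le hd hL y (z / u)
    have h2 := abs_sub_sub_deriv_mul_le_of_abs_deriv_le hd hL (-y) (-(z / u))
    rw [abs_neg, abs_of_pos hzu] at h2
    rw [abs_of_pos hzu] at h1
    calc _ ≤ u * (2 * L * (z / u) + 2 * L * (z / u)) :=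
          mul_le_mul_of_nonneg_left ((abs_add_le _ _).trans (add_le_add h1 h2)) hu.le
      _ = (4 * L) * z := by field_simp; ring
      _ ≤ _ := by gcongr; linarith

/-- An integrand that is `O(z² / u)` for `z ≤ u` and `O(z)` for `z > u` has `ν_α`-integral
`O(u^{1-α})`. -/
lemma abs_integral_nuMeasure_le {α Cα A u : ℝ} (hα : α ∈ Ioo (1 : ℝ) 2) (hCα : 0 < Cα)
    (hu : 0 < u) {f : ℝ → ℝ}
    (hf : ∀ z, 0 < z → |f z| ≤ A * z ^ 2 / u ∧ |f z| ≤ A * z) :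
    |∫ z, f z ∂(nuMeasure Cα α)|
      ≤ Cα * A * (1 / (2 - α) + 1 / (α - 1)) * u ^ (1 - α) := by
  obtain ⟨hα1, hα2⟩ := hα
  have hsmall : IntegrableOn (fun z : ℝ => Cα * A / u * z ^ (1 - α)) (Ioc 0 u) :=
    ((intervalIntegral.intervalIntegrable_rpow' (by linarith : -1 < 1 - α)).const_mul
      (Cα * A / u)).1
  have hlarge : IntegrableOn (fun z : ℝ => Cα * A * z ^ (-α)) (Ioi u) :=
    (integrableOn_Ioi_rpow_of_lt (by linarith : -α < -1) hu).const_mul _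
  have hind₁ := hsmall.integrable_indicator measurableSet_Ioc
  have hind₂ := hlarge.integrable_indicator measurableSet_Ioi
  have hmeas : Measurable fun z : ℝ => ENNReal.ofReal (Cα * z ^ (-(1 + α))) := by fun_prop
  rw [nuMeasure, integral_withDensity_eq_integral_toReal_smul hmeas
    (Filter.Eventually.of_forall fun _ => ENNReal.ofReal_lt_top)]
  have hbound := norm_integral_le_of_norm_le (μ := volume.restrict (Ioi (0 : ℝ)))
    (f := fun z => (ENNReal.ofReal (Cα * z ^ (-(1 + α)))).toReal • f z)
    (hind₁.restrict.add hind₂.restrict) (by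
      refine (ae_restrict_mem measurableSet_Ioi).mono fun z (hz : 0 < z) => ?_
      have hw : 0 ≤ Cα * z ^ (-(1 + α)) := by positivity
      rw [ENNReal.toReal_ofReal hw, smul_eq_mul, Real.norm_eq_abs, abs_mul, abs_of_nonneg hw]
      by_cases hzu : z ≤ u
      · have hmem : z ∈ Ioc 0 u := ⟨hz, hzu⟩
        have hnot : z ∉ Ioi u := by simpa using hzu
        have hpow : z ^ (1 - α) = z ^ (-(1 + α)) * z ^ 2 := by
          rw [← Real.rpow_natCast z 2, ← Real.rpow_add hz]
          congr 1
          push_cast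
          ring
        simp only [Pi.add_apply, indicator_of_mem hmem, indicator_of_notMem hnot, add_zero]
        calc _ ≤ Cα * z ^ (-(1 + α)) * (A * z ^ 2 / u) :=
              mul_le_mul_of_nonneg_left (hf z hz).1 hw
          _ = _ := by rw [hpow]; ring
      · have hnot : z ∉ Ioc 0 u := fun h => hzu h.2
        have hmem : z ∈ Ioi u := not_le.mp hzu
        have hpow : z ^ (-α) = z ^ (-(1 + α)) * z := by
          rw [← Real.rpow_add_one hz.ne']
          congr 1
          ring
        simp only [Pi.add_apply, indicator_of_mem hmem, indicator_of_notMem hnot, zero_add]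
        calc _ ≤ Cα * z ^ (-(1 + α)) * (A * z) := mul_le_mul_of_nonneg_left (hf z hz).2 hw
          _ = _ := by rw [hpow]; ring)
  refine hbound.trans (le_of_eq ?_)
  simp only [Pi.add_apply]
  rw [integral_add hind₁.restrict hind₂.restrict, setIntegral_indicator measurableSet_Ioc,
    setIntegral_indicator measurableSet_Ioi, inter_eq_self_of_subset_right Ioc_subset_Ioi_self,
    inter_eq_self_of_subset_right (Ioi_subset_Ioi hu.le), integral_const_mul, integral_const_mul,
    integral_Ioi_rpow_of_lt (by linarith) hu, ← intervalIntegral.integral_of_le hu.le,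
    integral_rpow (Or.inl (by linarith)), Real.zero_rpow (by linarith),
    Real.rpow_add_one hu.ne',
    show -α + 1 = 1 - α by ring]
  have h1 : α - 1 ≠ 0 := by linarith
  have h2 : 2 - α ≠ 0 := by linarith
  rw [show 1 - α + 1 = 2 - α by ring, show (1 : ℝ) - α = -(α - 1) by ring]
  field_simp
  ring

/-- Estimate \eqref{T4}: there is `c₁ > 0` such that for all `u > 0` and
`x, x̃ ∈ ℝ`, with `v = |x - x̃|`,
`-λ v ∂₂F(u,v) + u ∫₀^∞ (F(u,|x-x̃+z|) - F(u,v) - ∂₂F(u,v) σ z) ν_α(dz)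
  ≤ -λ v 1_{v ≥ 2u} + c₁ (u + u^{2-α})`. -/
theorem stmt16 (lam α Cα δ : ℝ) (hlam : 0 < lam) (hα : α ∈ Ioo (1 : ℝ) 2)
    (hCα : 0 < Cα) (hδ : 0 < δ)
    (g : ℝ → ℝ) (hg : IsCutoff δ g) :
    ∃ c₁ : ℝ, 0 < c₁ ∧ ∀ u x xt : ℝ, 0 < u →
      -lam * |x - xt| * D2 (Fcut g) u |x - xt|
          + u * ∫ z, (Fcut g u |x - xt + z| - Fcut g u |x - xt|
              - D2 (Fcut g) u |x - xt| * sgn' x xt * z) ∂(nuMeasure Cα α)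
        ≤ -lam * |x - xt| * (if 2 * u ≤ |x - xt| then 1 else 0)
          + c₁ * (u + u ^ (2 - α)) := by
  obtain ⟨A, hA, hinc⟩ := hg.exists_abs_Fcut_increment_le
  have h2α : 0 < 2 - α := by linarith [hα.2]
  have hα1 : 0 < α - 1 := by linarith [hα.1]
  refine ⟨Cα * A * (1 / (2 - α) + 1 / (α - 1)), by positivity, fun u x xt hu => ?_⟩
  have hint := abs_integral_nuMeasure_le hα hCα hu (fun z hz => hinc u x xt z hu hz)
  have hdrift : -lam * |x - xt| * D2 (Fcut g) u |x - xt|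
      ≤ -lam * |x - xt| * (if 2 * u ≤ |x - xt| then 1 else 0) := by
    refine mul_le_mul_of_nonpos_left ?_
      (mul_nonpos_of_nonpos_of_nonneg (by linarith) (abs_nonneg _))
    rw [hg.D2_Fcut hu (abs_nonneg _)]
    split_ifs with h
    · rw [hg.deriv_cutProfile_of_two_le ((le_div_iff₀ hu).mpr h)]
    · exact hg.monotone_cutProfile.deriv_nonneg
  refine add_le_add hdrift ?_
  calc _ ≤ u * (Cα * A * (1 / (2 - α) + 1 / (α - 1)) * u ^ (1 - α)) :=
        mul_le_mul_of_nonneg_left ((le_abs_self _).trans hint) hu.le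
    _ = Cα * A * (1 / (2 - α) + 1 / (α - 1)) * u ^ (2 - α) := by
        rw [show 2 - α = 1 - α + 1 by ring, Real.rpow_add_one hu.ne']
        ring
    _ ≤ _ := by gcongr; linarith
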